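/- Let n ≥ 2. Then there is a constant c(n) such that for all X ≥ 2, F_n(X) ≤ c(n) · X^{(n+2)/4}, where F_n(X) denotes the number of number fields K (inside a fixed algebraic closure of ℚ) with [K:ℚ] = n and |Δ_K| ≤ X. -/

import Mathlib

open Polynomial

noncomputable section

/-- A fixed algebraic closure of `ℚ`. -/
abbrev Qbar : Type := AlgebraicClosure ℚ

/-- The discriminant of a subfield of `ℚ̄` (zero if it is not a number field). -/
def fieldDiscr (K : IntermediateField ℚ Qbar) : ℤ := by
  by_cases h : FiniteDimensional ℚ K
  · exact @NumberField.discr K _ ⟨⟩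
  · exact 0

/-- The action of `Gal(ℚ̄/ℚ)` on the embeddings of `K` into `ℚ̄`; its image is the
Galois group of the Galois closure of `K`, acting on the embeddings of `K`. -/
def galAct (K : IntermediateField ℚ Qbar) :
    (Qbar ≃ₐ[ℚ] Qbar) →* Equiv.Perm (K →ₐ[ℚ] Qbar) where
  toFun σ :=
    { toFun := fun ι => σ.toAlgHom.comp ι
      invFun := fun ι => σ.symm.toAlgHom.comp ι
      left_inv := fun ι => by ext x; simp
      right_inv := fun ι => by ext x; simp }
  map_one' := by
    apply Equiv.ext; intro ι; ext x; simp
  map_mul' := fun σ τ => by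
    apply Equiv.ext; intro ι; ext x; simp

/-- `K` has Galois group (of its Galois closure, acting on the `n` embeddings of `K` in `ℚ̄`)
equal to `G`, up to conjugacy; this is encoded by an identification of the embeddings
with `Fin n` under which the image of the Galois action is exactly `G`. -/
def HasGalGroup (n : ℕ) (K : IntermediateField ℚ Qbar)
    (G : Subgroup (Equiv.Perm (Fin n))) : Prop :=
  ∃ e : (K →ₐ[ℚ] Qbar) ≃ Fin n, ∀ σ : Equiv.Perm (Fin n),
    σ ∈ G ↔ ∃ g : Qbar ≃ₐ[ℚ] Qbar, Equiv.permCongr e (galAct K g) = σ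

/-- The number of number fields of degree `n`, absolute discriminant at most `X`,
and Galois group (as a permutation group on the embeddings) conjugate to `G`. -/
def FnG (n : ℕ) (X : ℝ) (G : Subgroup (Equiv.Perm (Fin n))) : ℕ :=
  Nat.card {K : IntermediateField ℚ Qbar //
    Module.finrank ℚ K = n ∧ |(fieldDiscr K : ℝ)| ≤ X ∧ HasGalGroup n K G}

/-- The number of number fields of degree `n` and absolute discriminant at most `X`. -/
def FnAll (n : ℕ) (X : ℝ) : ℕ :=
  Nat.card {K : IntermediateField ℚ Qbar //
    Module.finrank ℚ K = n ∧ |(fieldDiscr K : ℝ)| ≤ X}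

/-- A subgroup of the permutations of `β` is transitive. -/
def IsTransitiveSub {β : Type*} (G : Subgroup (Equiv.Perm β)) : Prop :=
  ∀ x y : β, ∃ σ ∈ G, σ x = y

/-- `G` admits a nontrivial block system: a partition of `β` into `k ≥ 2` nonempty parts,
some part having at least two elements, whose parts are permuted by every element of `G`. -/
def HasBlockSystem {β : Type*} (G : Subgroup (Equiv.Perm β)) : Prop :=
  ∃ (k : ℕ) (R : Fin k → Set β), 2 ≤ k ∧
    (∀ j, (R j).Nonempty) ∧
    (∃ j, 2 ≤ Nat.card (R j)) ∧
    (∀ x : β, ∃! j, x ∈ R j) ∧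
    (∀ σ ∈ G, ∀ i, ∃ j, (fun x => σ x) '' R i = R j)

/-- An imprimitive permutation group: transitive with a nontrivial block system. -/
def IsImprimitiveSub {β : Type*} (G : Subgroup (Equiv.Perm β)) : Prop :=
  IsTransitiveSub G ∧ HasBlockSystem G

/-- A primitive permutation group: transitive with no nontrivial block system. -/
def IsPrimitiveSub {β : Type*} (G : Subgroup (Equiv.Perm β)) : Prop :=
  IsTransitiveSub G ∧ ¬ HasBlockSystem G

end

instance : Algebra.IsAlgebraic ℚ Qbar := by
  have := AlgebraicClosure.isAlgebraic ℚ
  convert! this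

instance : IsAlgClosure ℚ Qbar := ⟨inferInstance, inferInstance⟩

instance (k : IntermediateField ℚ Qbar) : Algebra.IsAlgebraic k Qbar :=
  Algebra.IsAlgebraic.tower_top (K := ℚ) k

instance (k : IntermediateField ℚ Qbar) : Normal k Qbar :=
  have : Normal ℚ Qbar := IsAlgClosure.normal ℚ _
  Normal.tower_top_of_normal ℚ k Qbar

/-- All the complex conjugates of `y` have absolute value at most `B`. -/
def ConjBdd (B : ℝ) (y : Qbar) : Prop := ∀ σ : Qbar →+* ℂ, ‖σ y‖ ≤ B

open NumberField in
/-- An algebraic integer of a number field all of whose conjugates have absolute value `< 1`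
vanishes. -/
theorem eq_zero_of_conj_lt_one {k : IntermediateField ℚ Qbar} [FiniteDimensional ℚ k]
    (c : 𝓞 k) (h : ∀ σ : Qbar →+* ℂ, ‖σ ((c : k) : Qbar)‖ < 1) : c = 0 := by
  have : NumberField k := ⟨⟩
  by_contra hc
  have key : ∀ w : InfinitePlace k, w (c : k) < 1 := by
    intro w
    have := h (ComplexEmbedding.lift Qbar w.embedding)
    rwa [← InfinitePlace.norm_embedding_eq,
      ← ComplexEmbedding.lift_algebraMap_apply Qbar w.embedding]
  obtain ⟨w⟩ : Nonempty (InfinitePlace k) := inferInstance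
  exact (InfinitePlace.one_le_of_lt_one hc (fun z _ => key z)).not_gt (key w)

open NumberField in
/-- A number field of degree `d` has at most `N ^ d` integers whose conjugates are all bounded by
`R`, if `2 * R < N`. -/
theorem integers_conjBdd_ncard_le (k : IntermediateField ℚ Qbar) [FiniteDimensional ℚ k]
    {R : ℝ} {N : ℕ} (hN : 0 < N) (hR : 2 * R < N) :
    {a : Qbar | a ∈ k ∧ IsIntegral ℤ a ∧ ConjBdd R a}.Finite ∧
    {a : Qbar | a ∈ k ∧ IsIntegral ℤ a ∧ ConjBdd R a}.ncard ≤ N ^ Module.finrank ℚ k := by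
  have : NumberField k := ⟨⟩
  set S := {a : Qbar | a ∈ k ∧ IsIntegral ℤ a ∧ ConjBdd R a} with hS
  have hint : ∀ a : S, IsIntegral ℤ (⟨a.1, a.2.1⟩ : k) := fun a =>
    (isIntegral_algHom_iff (k.val.restrictScalars ℤ) k.val.injective).mp a.2.2.1
  let f : S → 𝓞 k ⧸ Ideal.span {(N : 𝓞 k)} := fun a => Ideal.Quotient.mk _ ⟨⟨a.1, a.2.1⟩, hint a⟩
  have hN0 : (N : 𝓞 k) ≠ 0 := by exact_mod_cast hN.ne'
  have hcard : Nat.card (𝓞 k ⧸ Ideal.span {(N : 𝓞 k)}) = N ^ Module.finrank ℚ k := by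
    have := Ideal.absNorm_span_natCast (S := 𝓞 k) N
    rwa [RingOfIntegers.rank, Ideal.absNorm_apply, Submodule.cardQuot_apply] at this
  have hf : Function.Injective f := by
    intro a b hab
    replace hab := Ideal.mem_span_singleton.mp (Ideal.Quotient.eq.mp hab)
    obtain ⟨c, hc⟩ := hab
    have hc' : (a.1 - b.1 : Qbar) = N * ((c : k) : Qbar) := by
      refine (congrArg (fun z : 𝓞 k => ((z : k) : Qbar)) hc).trans ?_
      simp
    have hc0 : c = 0 := by
      refine eq_zero_of_conj_lt_one c fun σ => ?_
      have h1 := congrArg (fun z => ‖σ z‖) hc'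
      simp only [map_sub, map_mul, map_natCast, norm_mul, Complex.norm_natCast] at h1
      have h2 := (norm_sub_le (σ a.1) (σ b.1)).trans (add_le_add (a.2.2.2 σ) (b.2.2.2 σ))
      have hN' : (0 : ℝ) < N := by exact_mod_cast hN
      nlinarith
    rw [hc0] at hc'
    simp only [map_zero, ZeroMemClass.coe_zero, mul_zero] at hc'
    exact Subtype.ext (sub_eq_zero.mp hc')
  have : Finite (𝓞 k ⧸ Ideal.span {(N : 𝓞 k)}) :=
    Nat.finite_of_card_ne_zero (by rw [hcard]; positivity)
  have : Finite S := Finite.of_injective f hf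
  refine ⟨S.toFinite, ?_⟩
  rw [← hcard, ← Nat.card_coe_set_eq]
  exact Nat.card_le_card_of_injective f hf

/-- The coefficients of the minimal polynomial over `k` of a bounded algebraic integer are
bounded algebraic integers. -/
theorem minpoly_coeff_conjBdd (k : IntermediateField ℚ Qbar) [FiniteDimensional ℚ k]
    {y : Qbar} (hy : IsIntegral ℤ y) {B : ℝ} (hB : ConjBdd B y) (i : ℕ) :
    IsIntegral ℤ (((minpoly k y).coeff i : k) : Qbar) ∧
    ConjBdd (B ^ ((minpoly k y).natDegree - i) * (minpoly k y).natDegree.choose i)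
      (((minpoly k y).coeff i : k) : Qbar) := by
  constructor
  · have : NumberField k := ⟨⟩
    let A := NumberField.RingOfIntegers k
    have hyA : IsIntegral A y := hy.tower_top
    have := minpoly.isIntegrallyClosed_eq_field_fractions' k hyA
    rw [this, coeff_map]
    have h1 := ((minpoly A y).coeff i).2
    exact (isIntegral_algHom_iff (k.val.restrictScalars ℤ) k.val.injective).mpr h1
  · intro σ
    have hyk : IsIntegral k y := hy.tower_top
    have hs : ((minpoly k y).map (algebraMap k Qbar)).Splits := IsAlgClosed.splits _
    have := coeff_le_of_roots_le (p := minpoly k y) (f := σ.comp (algebraMap k Qbar)) (B := B) i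
      (minpoly.monic hyk) (IsAlgClosed.splits _) (by
        intro z hz
        rw [← Polynomial.map_map, hs.roots_map σ, Multiset.mem_map] at hz
        obtain ⟨w, hw, rfl⟩ := hz
        rw [mem_roots', IsRoot.def, eval_map_algebraMap] at hw
        obtain ⟨τ, rfl⟩ := minpoly.exists_algEquiv_of_root' (Algebra.IsAlgebraic.isAlgebraic y) hw.2
        exact hB (σ.comp τ.toRingEquiv.toRingHom))
    rw [coeff_map] at this
    exact this

/-- The algebraic integers of degree `m` over `k`, of trace zero over `k`, all of whose conjugates
are bounded by `B`. -/
def boundedGenerators (k : IntermediateField ℚ Qbar) (m : ℕ) (B : ℝ) : Set Qbar :=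
  {y | IsIntegral ℤ y ∧ (minpoly k y).natDegree = m ∧ (minpoly k y).nextCoeff = 0 ∧ ConjBdd B y}

theorem sum_sub_fin (p : ℕ) : 2 * ∑ i : Fin p, (p + 1 - (i : ℕ)) = p * (p + 3) := by
  rw [Fin.sum_univ_eq_sum_range (fun i => p + 1 - i)]
  induction p with
  | zero => simp
  | succ p ih =>
    rw [Finset.sum_range_succ']
    simp only [Nat.add_sub_add_right, mul_add, ih]
    simp
    ring

theorem natDegree_X_pow_add_sum_fin {A : Type*} [CommRing A] [Nontrivial A] {p : ℕ}
    (v : Fin p → A) : (X ^ (p + 1) + ∑ i : Fin p, C (v i) * X ^ (i : ℕ)).natDegree = p + 1 := by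
  refine natDegree_eq_of_degree_eq_some ?_
  rw [degree_add_eq_left_of_degree_lt, degree_X_pow]
  rw [degree_X_pow]
  exact (degree_sum_fin_lt v).trans (by exact_mod_cast Nat.lt_succ_self p)

theorem boundedGenerators_ncard_le (k : IntermediateField ℚ Qbar) [FiniteDimensional ℚ k]
    {p : ℕ} (hp : 0 < p) {B : ℝ} (hB : 1 ≤ B) :
    (boundedGenerators k (p + 1) B).Finite ∧
    ((boundedGenerators k (p + 1) B).ncard : ℝ) ≤
      (p + 1) * (∏ i : Fin p, 3 * (B ^ (p + 1 - (i : ℕ)) * (p + 1).choose i)) ^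
        Module.finrank ℚ k := by
  classical
  set R : Fin p → ℝ := fun i => B ^ (p + 1 - (i : ℕ)) * (p + 1).choose i with hR
  have hR1 : ∀ i, 1 ≤ R i := fun i =>
    one_le_mul_of_one_le_of_one_le (one_le_pow₀ hB)
      (by exact_mod_cast Nat.choose_pos (by omega))
  have hS := fun i => integers_conjBdd_ncard_le k (R := R i) (N := ⌊2 * R i⌋₊ + 1) (by omega)
    (by push_cast; exact Nat.lt_floor_add_one _)
  let P : Finset (Fin p → Qbar) := Fintype.piFinset fun i => (hS i).1.toFinset
  let F : (Fin p → Qbar) → Qbar[X] := fun v => X ^ (p + 1) + ∑ i : Fin p, C (v i) * X ^ (i : ℕ)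
  have hFdeg : ∀ v, (F v).natDegree = p + 1 := natDegree_X_pow_add_sum_fin
  have hF0 : ∀ v, F v ≠ 0 := fun v h => by simpa [h] using hFdeg v
  have hsub : boundedGenerators k (p + 1) B ⊆ (P.biUnion fun v => (F v).roots.toFinset) := by
    rintro y ⟨hy, hdy, hny, hBy⟩
    have hc := minpoly_coeff_conjBdd k hy hBy
    rw [hdy] at hc
    simp only [Finset.coe_biUnion, Set.mem_iUnion, Finset.mem_coe]
    refine ⟨fun i => (((minpoly k y).coeff i : k) : Qbar), ?_, ?_⟩
    · simp only [P, Fintype.mem_piFinset, Set.Finite.mem_toFinset]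
      exact fun i => ⟨SetLike.coe_mem _, (hc i).1, (hc i).2⟩
    · rw [Multiset.mem_toFinset, mem_roots (hF0 _), IsRoot.def]
      have h0 := minpoly.aeval k y
      rw [aeval_eq_sum_range, hdy, Finset.sum_range_succ, Finset.sum_range_succ,
        ← Fin.sum_univ_eq_sum_range (fun i => (minpoly k y).coeff i • y ^ i)] at h0
      have h1 : (minpoly k y).coeff (p + 1) = 1 := by
        rw [← hdy]; exact minpoly.monic hy.tower_top
      have h2 : (minpoly k y).coeff p = 0 := by
        rwa [nextCoeff, hdy, if_neg (by omega)] at hny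
      rw [h1, h2, zero_smul, one_smul, add_zero] at h0
      simp only [F, eval_add, eval_pow, eval_X, eval_finsetSum, eval_mul, eval_C]
      rw [add_comm]
      exact h0
  refine ⟨(Finset.finite_toSet _).subset hsub, ?_⟩
  have h1 : (boundedGenerators k (p + 1) B).ncard ≤ P.card * (p + 1) := by
    refine (Set.ncard_le_ncard hsub (Finset.finite_toSet _)).trans ?_
    rw [Set.ncard_coe_finset]
    refine Finset.card_biUnion_le_card_mul _ _ _ fun v _ => ?_
    exact (Multiset.toFinset_card_le _).trans ((card_roots' _).trans (hFdeg v).le)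
  have h2 : (P.card : ℝ) ≤ (∏ i : Fin p, 3 * R i) ^ Module.finrank ℚ k := by
    rw [Fintype.card_piFinset, ← Finset.prod_pow]
    push_cast
    refine Finset.prod_le_prod (fun _ _ => by positivity) fun i _ => ?_
    rw [← Set.ncard_eq_toFinset_card _ (hS i).1]
    refine (Nat.cast_le.mpr (hS i).2).trans ?_
    push_cast
    gcongr
    have := Nat.floor_le (a := 2 * R i) (by linarith [hR1 i])
    linarith [hR1 i]
  calc ((boundedGenerators k (p + 1) B).ncard : ℝ) ≤ P.card * (p + 1) := by exact_mod_cast h1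
    _ ≤ _ := by rw [mul_comm]; gcongr

open MeasureTheory Pointwise in
/-- A set each of whose translates contains at most `M` points of a lattice has measure at most
`M` times the covolume of the lattice. -/
theorem measure_le_mul_of_encard_le {E L : Type*} [MeasurableSpace E] {μ : Measure E} {F S : Set E}
    [AddGroup L] [Countable L] [AddAction L E] [MeasurableSpace L] [MeasurableVAdd L E]
    [VAddInvariantMeasure L E μ] (hF : IsAddFundamentalDomain L F μ) (hS : MeasurableSet S)
    {M : ℕ} (hM : ∀ t : E, {g : L | t ∈ g +ᵥ S}.encard ≤ M) :
    μ S ≤ M * μ F := by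
  have h1 : ∀ g : L, μ ((g +ᵥ S) ∩ F) = ∫⁻ t in F, (g +ᵥ S).indicator 1 t ∂μ := fun g => by
    rw [lintegral_indicator_one (hS.const_vadd g), Measure.restrict_apply (hS.const_vadd g)]
  rw [hF.measure_eq_tsum, tsum_congr h1, ← lintegral_tsum
    (fun g => (measurable_one.indicator (hS.const_vadd g)).aemeasurable)]
  calc ∫⁻ t in F, ∑' g : L, (g +ᵥ S).indicator 1 t ∂μ ≤ ∫⁻ _ in F, (M : ENNReal) ∂μ := by
        refine lintegral_mono fun t => ?_
        have : ∀ g : L, (g +ᵥ S).indicator (1 : E → ENNReal) t =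
            {g : L | t ∈ g +ᵥ S}.indicator 1 g := fun g => rfl
        rw [tsum_congr this, ← tsum_subtype]
        simp only [Pi.one_apply, ENNReal.tsum_set_one]
        exact_mod_cast ENat.toENNReal_le.mpr (hM t)
    _ = M * μ F := by rw [setLIntegral_const]

open NumberField in
theorem conjBdd_of_infinitePlace_lt {K : IntermediateField ℚ Qbar} {B : ℝ} {x : K}
    (h : ∀ w : InfinitePlace K, w x < B) : ConjBdd B (x : Qbar) := fun σ => by
  have := h (InfinitePlace.mk (σ.comp (algebraMap K Qbar)))
  rw [InfinitePlace.apply] at this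
  exact this.le

open NumberField MeasureTheory Pointwise NNReal in
/-- If every integer of `K` with conjugates bounded by `2 * T` lies in the subfield `k`, then
`T` is bounded in terms of the discriminant of `K`. -/
theorem pow_le_of_forall_mem {k K : IntermediateField ℚ Qbar} [NumberField K] (hkK : k ≤ K)
    {T : ℝ≥0} (hT : 1 ≤ T)
    (h : ∀ x ∈ K, IsIntegral ℤ x → ConjBdd (2 * T) x → x ∈ k) :
    (T : ℝ) ^ Module.finrank ℚ K ≤ (5 * T) ^ Module.finrank ℚ k * √|(discr K : ℝ)| := by
  classical
  have : FiniteDimensional ℚ k :=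
    FiniteDimensional.of_injective (IntermediateField.inclusion hkK).toLinearMap
      (IntermediateField.inclusion hkK).injective
  obtain ⟨hfin, hcard⟩ := integers_conjBdd_ncard_le k (R := 2 * T) (N := ⌊2 * (2 * (T : ℝ))⌋₊ + 1)
    (by omega) (by push_cast; exact Nat.lt_floor_add_one _)
  set N := ⌊2 * (2 * (T : ℝ))⌋₊ + 1 with hN
  set A : Set Qbar := {a : Qbar | a ∈ k ∧ IsIntegral ℤ a ∧ ConjBdd (2 * T) a}
  let L := mixedEmbedding.integerLattice K
  choose ψ hψ using fun g : L => g.2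
  replace hψ : ∀ g : L, mixedEmbedding K (ψ g : K) = g := hψ
  have : Countable L := inferInstance
  have : MeasurableVAdd L (mixedEmbedding.mixedSpace K) :=
    inferInstanceAs (MeasurableVAdd L.toAddSubgroup (mixedEmbedding.mixedSpace K))
  have : VAddInvariantMeasure L (mixedEmbedding.mixedSpace K) volume :=
    inferInstanceAs (VAddInvariantMeasure L.toAddSubgroup (mixedEmbedding.mixedSpace K) volume)
  have key := measure_le_mul_of_encard_le (mixedEmbedding.fundamentalDomain_integerLattice K)
    (S := mixedEmbedding.convexBodyLT K fun _ => T)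
    ((MeasurableSet.univ_pi fun _ => measurableSet_ball).prod
      (MeasurableSet.univ_pi fun _ => measurableSet_ball)) (M := N ^ Module.finrank ℚ k)
    (by
      intro t
      rcases Set.eq_empty_or_nonempty {g : L | t ∈ g +ᵥ mixedEmbedding.convexBodyLT K fun _ => T}
        with h0 | ⟨g₀, hg₀⟩
      · rw [h0]; simp
      · have h1 := Set.encard_le_encard_of_injOn (t := A)
          (f := fun g : L => ((ψ g - ψ g₀ : K) : Qbar))
          (s := {g : L | t ∈ g +ᵥ mixedEmbedding.convexBodyLT K fun _ => T}) ?_ ?_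
        · refine h1.trans ?_
          rw [← hfin.cast_ncard_eq]
          exact_mod_cast hcard
        · intro g hg
          have hi : IsIntegral ℤ (((ψ g - ψ g₀ : K)) : Qbar) :=
            (isIntegral_algHom_iff (K.val.restrictScalars ℤ) K.val.injective).mpr
              ((ψ g - ψ g₀).2)
          have hb : ConjBdd (2 * T) (((ψ g - ψ g₀ : K)) : Qbar) := by
            refine conjBdd_of_infinitePlace_lt (B := 2 * T) ?_
            refine (mixedEmbedding.convexBodyLT_mem K (f := fun _ => 2 * T)).mp ?_
            rw [map_sub, hψ, hψ]
            obtain ⟨s, hs, hs'⟩ := hg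
            obtain ⟨s₀, hs₀, hs₀'⟩ := hg₀
            have : (g : mixedEmbedding.mixedSpace K) - g₀ = s₀ - s := by
              have : (g : mixedEmbedding.mixedSpace K) + s = g₀ + s₀ := hs'.trans hs₀'.symm
              rw [sub_eq_sub_iff_add_eq_add, this, add_comm]
            rw [this]
            refine ⟨fun w _ => ?_, fun w _ => ?_⟩
            · have h1 := hs.1 w trivial
              have h2 := hs₀.1 w trivial
              rw [mem_ball_zero_iff] at h1 h2 ⊢
              exact (norm_sub_le _ _).trans_lt ((add_lt_add h2 h1).trans_eq (two_mul (T : ℝ)).symm)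
            · have h1 := hs.2 w trivial
              have h2 := hs₀.2 w trivial
              rw [mem_ball_zero_iff] at h1 h2 ⊢
              exact (norm_sub_le _ _).trans_lt ((add_lt_add h2 h1).trans_eq (two_mul (T : ℝ)).symm)
          exact ⟨h _ (SetLike.coe_mem _) hi hb, hi, hb⟩
        · intro g _ g' _ hgg
          have : (ψ g : K) = ψ g' := by simpa using hgg
          exact Subtype.ext (by rw [← hψ g, ← hψ g', this]))
  rw [mixedEmbedding.convexBodyLT_volume,
    mixedEmbedding.volume_fundamentalDomain_latticeBasis] at key
  have hk : (T : ENNReal) ^ Module.finrank ℚ K ≤ ((N ^ Module.finrank ℚ k : ℕ) : ENNReal) *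
      ((NNReal.sqrt ‖discr K‖₊ : ℝ≥0) : ENNReal) := by
    rw [Finset.prod_pow_eq_pow_sum, InfinitePlace.sum_mult_eq] at key
    calc (T : ENNReal) ^ Module.finrank ℚ K
        = 1 * ((T ^ Module.finrank ℚ K : ℝ≥0) : ENNReal) := by rw [one_mul]; push_cast; rfl
      _ ≤ (mixedEmbedding.convexBodyLTFactor K) * ((T ^ Module.finrank ℚ K : ℝ≥0) : ENNReal) := by
        gcongr
        exact_mod_cast mixedEmbedding.one_le_convexBodyLTFactor K
      _ ≤ _ := by
        refine key.trans ?_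
        gcongr
        refine mul_le_of_le_one_left (by positivity) (pow_le_one₀ (by positivity) ?_)
        simp
  have hk' : T ^ Module.finrank ℚ K ≤ ((N ^ Module.finrank ℚ k : ℕ) : ℝ≥0) *
      NNReal.sqrt ‖discr K‖₊ := by exact_mod_cast hk
  have hk'' : (T : ℝ) ^ Module.finrank ℚ K ≤ (N : ℝ) ^ Module.finrank ℚ k * √|(discr K : ℝ)| := by
    have := NNReal.coe_le_coe.mpr hk'
    simpa [Int.norm_eq_abs] using this
  refine hk''.trans ?_
  gcongr
  have h1 := Nat.floor_le (a := 2 * (2 * (T : ℝ))) (by positivity)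
  have h2 : (1 : ℝ) ≤ T := by exact_mod_cast hT
  rw [hN]; push_cast; linarith

open NumberField in
/-- A proper extension `K` of `k` has an integer outside `k` which is small in terms of
the discriminant of `K`. -/
theorem exists_integer_notMem {k K : IntermediateField ℚ Qbar} [NumberField K] (hkK : k < K)
    {X : ℝ} (hX : 1 ≤ X) (hK : |(discr K : ℝ)| ≤ X) {n d : ℕ} (hn : Module.finrank ℚ K = n)
    (hd : Module.finrank ℚ k = d) (hdn : d < n) :
    ∃ x ∈ K, x ∉ k ∧ IsIntegral ℤ x ∧
      ConjBdd (4 * 5 ^ n * X ^ (1 / (2 * ((n : ℝ) - d)))) x := by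
  by_contra! hcon
  set Y : ℝ := X ^ (1 / (2 * ((n : ℝ) - d))) with hY
  have hdn' : (0 : ℝ) < (n : ℝ) - d := by
    have : (d : ℝ) < n := by exact_mod_cast hdn
    linarith
  have hY1 : 1 ≤ Y := Real.one_le_rpow hX (by positivity)
  have hYpow : Y ^ (n - d) = √X := by
    rw [hY, ← Real.rpow_natCast, ← Real.rpow_mul (by linarith), Real.sqrt_eq_rpow,
      Nat.cast_sub hdn.le]
    congr 1
    field_simp
  let T : NNReal := ⟨2 * 5 ^ n * Y, by positivity⟩
  have hTc : (T : ℝ) = 2 * 5 ^ n * Y := rfl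
  have h5 : (1 : ℝ) ≤ 5 ^ n := one_le_pow₀ (by norm_num)
  have hT : (1 : ℝ) ≤ T := by rw [hTc]; nlinarith
  have := pow_le_of_forall_mem hkK.le (T := T) hT (fun x hxK hx hb => by
    by_contra hxk
    refine hcon x hxK hxk hx ?_
    convert hb using 1
    rw [hTc]; ring)
  rw [hn, hd, mul_pow] at this
  have h1 : (T : ℝ) ^ (n - d) ≤ 5 ^ d * √X := by
    have h2 : (T : ℝ) ^ n = T ^ d * T ^ (n - d) := by rw [← pow_add]; congr 1; omega
    have h3 : (0 : ℝ) < T ^ d := by positivity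
    rw [h2] at this
    have h4 := this.trans (mul_le_mul_of_nonneg_left (Real.sqrt_le_sqrt hK) (by positivity))
    nlinarith
  have h2 : (2 * 5 ^ n : ℝ) ≤ (2 * 5 ^ n) ^ (n - d) := le_self_pow₀ (by linarith) (by omega)
  rw [hTc, mul_pow, hYpow] at h1
  have h3 : (0 : ℝ) < √X := Real.sqrt_pos.mpr (by linarith)
  have h4 : (5 : ℝ) ^ d ≤ 5 ^ n := pow_le_pow_right₀ (by norm_num) hdn.le
  nlinarith

open IntermediateField in
/-- A bounded integral generator can be replaced by one of trace zero. -/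
theorem exists_boundedGenerators (k : IntermediateField ℚ Qbar) [FiniteDimensional ℚ k] {x : Qbar}
    (hx : IsIntegral ℤ x) {B : ℝ} (hB : ConjBdd B x) {m : ℕ} (hm : (minpoly k x).natDegree = m) :
    ∃ y ∈ boundedGenerators k m (2 * m * B), k⟮y⟯ = k⟮x⟯ := by
  have hxk : IsIntegral k x := Algebra.IsIntegral.isIntegral x
  have hm0 : 0 < m := hm ▸ minpoly.natDegree_pos hxk
  set c : k := (minpoly k x).nextCoeff with hc
  have hcc : c = (minpoly k x).coeff (m - 1) := by
    rw [hc, nextCoeff_of_natDegree_pos (hm ▸ hm0), hm]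
  obtain ⟨hci, hcB⟩ := minpoly_coeff_conjBdd k hx hB (m - 1)
  rw [← hcc, hm, Nat.sub_sub_self hm0, pow_one, Nat.choose_symm (by omega : 1 ≤ m),
    Nat.choose_one_right] at hcB
  rw [← hcc] at hci
  set y : Qbar := m * x + algebraMap k Qbar c with hy
  have hadj : k⟮y⟯ = k⟮x⟯ := by
    apply le_antisymm
    · rw [adjoin_simple_le_iff]
      exact add_mem (mul_mem (_root_.natCast_mem _ m) (mem_adjoin_simple_self k x))
        (_root_.algebraMap_mem _ c)
    · rw [adjoin_simple_le_iff]
      have : x = algebraMap k Qbar (m : k)⁻¹ * (y - algebraMap k Qbar c) := by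
        have : (m : Qbar) ≠ 0 := by exact_mod_cast hm0.ne'
        rw [hy, map_inv₀, map_natCast]
        field_simp
        ring
      rw [this]
      exact mul_mem (_root_.algebraMap_mem _ _)
        (sub_mem (mem_adjoin_simple_self k y) (_root_.algebraMap_mem _ c))
  have hyk : IsIntegral k y := Algebra.IsIntegral.isIntegral y
  refine ⟨y, ⟨((isIntegral_natCast _).mul hx).add hci, ?_, ?_, ?_⟩, hadj⟩
  · rw [← adjoin.finrank hyk, hadj, adjoin.finrank hxk, hm]
  · have : FiniteDimensional k k⟮x⟯ := adjoin.finiteDimensional hxk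
    have h0 : Algebra.trace k k⟮x⟯ (m • AdjoinSimple.gen k x + algebraMap k _ c) = 0 := by
      rw [map_add, map_nsmul, trace_adjoinSimpleGen hxk, Algebra.trace_algebraMap,
        adjoin.finrank hxk, hm, ← hc]
      simp
    rw [trace_eq_finrank_mul_minpoly_nextCoeff] at h0
    have h1 : minpoly k (m • AdjoinSimple.gen k x + algebraMap k k⟮x⟯ c) = minpoly k y := by
      rw [← minpoly.algebraMap_eq (algebraMap k⟮x⟯ Qbar).injective]
      congr 1
      rw [map_add, map_nsmul, AdjoinSimple.algebraMap_gen, nsmul_eq_mul,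
        ← IsScalarTower.algebraMap_apply]
    rw [h1] at h0
    simpa [Module.finrank_pos.ne'] using h0
  · intro σ
    have h1 := hB σ
    have h2 := hcB σ
    calc ‖σ y‖ ≤ ‖(m : ℂ) * σ x‖ + ‖σ (c : Qbar)‖ := by
          rw [hy, map_add, map_mul, map_natCast]; exact norm_add_le _ _
      _ ≤ m * B + B * m := by
          rw [norm_mul, Complex.norm_natCast]
          gcongr
      _ = 2 * m * B := by ring

theorem fieldDiscr_eq (K : IntermediateField ℚ Qbar) [NumberField K] :
    fieldDiscr K = NumberField.discr K := by
  rw [fieldDiscr, dif_pos (NumberField.to_finiteDimensional (K := K))]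

open NumberField in
theorem abs_discr_pow_le {k K : IntermediateField ℚ Qbar} [NumberField k] [NumberField K]
    (h : k ≤ K) {m : ℕ} (hm : Module.finrank ℚ k * m = Module.finrank ℚ K) :
    |(discr k : ℝ)| ^ m ≤ |(discr K : ℝ)| := by
  let _ : Algebra k K := (IntermediateField.inclusion h).toAlgebra
  have : IsScalarTower ℚ k K := .of_algebraMap_eq fun _ => by simp
  have h1 : Module.finrank k K = m := by
    have := Module.finrank_mul_finrank ℚ k K
    rw [← hm] at this
    exact Nat.eq_of_mul_eq_mul_left Module.finrank_pos this
  have h2 := natAbs_discr_eq_absNorm_differentIdeal_mul_natAbs_discr_pow k (𝓞 k) K (𝓞 K)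
  have h3 : (discr k).natAbs ^ m ≤ (discr K).natAbs := by
    refine Nat.le_of_dvd (Int.natAbs_pos.mpr (discr_ne_zero K)) ?_
    rw [h2, h1]
    exact dvd_mul_left _ _
  have h4 : (((discr k).natAbs ^ m : ℕ) : ℝ) ≤ ((discr K).natAbs : ℕ) := by exact_mod_cast h3
  simpa [Nat.cast_natAbs] using h4

open IntermediateField in
/-- The number of minimal extensions of relative degree `m` and bounded discriminant of a number
field of degree `d` is bounded uniformly in the base field. -/
theorem exists_ncard_covBy_le {d m : ℕ} (hd : 0 < d) (hm : 2 ≤ m) :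
    ∃ C : ℝ, 0 < C ∧ ∀ k : IntermediateField ℚ Qbar, Module.finrank ℚ k = d → ∀ X : ℝ, 1 ≤ X →
      {K | k ⋖ K ∧ Module.finrank ℚ K = d * m ∧ |(fieldDiscr K : ℝ)| ≤ X}.Finite ∧
      ({K | k ⋖ K ∧ Module.finrank ℚ K = d * m ∧ |(fieldDiscr K : ℝ)| ≤ X}.ncard : ℝ) ≤
        C * X ^ (((m : ℝ) + 2) / 4) := by
  obtain ⟨p, rfl⟩ : ∃ p, m = p + 1 := ⟨m - 1, by omega⟩
  have hp : 0 < p := by omega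
  set D : ℝ := 2 * (p + 1 : ℕ) * (4 * 5 ^ (d * (p + 1))) with hD
  have hD1 : 1 ≤ D := by
    have h5 : (1 : ℝ) ≤ 5 ^ (d * (p + 1)) := one_le_pow₀ (by norm_num)
    rw [hD]; push_cast
    nlinarith [(Nat.cast_nonneg p : (0 : ℝ) ≤ p)]
  refine ⟨(p + 1) * (∏ i : Fin p, 3 * (D ^ (p + 1 - (i : ℕ)) * (p + 1).choose i)) ^ d, ?_, ?_⟩
  · have : ∀ i : Fin p, (0 : ℝ) < (p + 1).choose i := fun i => by
      exact_mod_cast Nat.choose_pos (by omega)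
    exact mul_pos (by positivity) (pow_pos (Finset.prod_pos fun i _ => by
      have := this i; positivity) _)
  intro k hk X hX
  have : FiniteDimensional ℚ k := Module.finite_of_finrank_pos (by omega)
  set Y : ℝ := X ^ (1 / (2 * (((d * (p + 1) : ℕ) : ℝ) - d))) with hY
  have hd' : (0 : ℝ) < d := by exact_mod_cast hd
  have hp' : (0 : ℝ) < p := by exact_mod_cast hp
  have hsub : (((d * (p + 1) : ℕ) : ℝ) - d) = d * p := by push_cast; ring
  rw [hsub] at hY
  have hY1 : 1 ≤ Y := hY ▸ Real.one_le_rpow hX (by positivity)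
  have hYE : (Y ^ ∑ i : Fin p, (p + 1 - (i : ℕ))) ^ d = X ^ ((((p + 1 : ℕ) : ℝ) + 2) / 4) := by
    have h := congrArg (Nat.cast (R := ℝ)) (sum_sub_fin p)
    rw [Nat.cast_mul] at h
    rw [hY, ← pow_mul, ← Real.rpow_natCast, ← Real.rpow_mul (by linarith), Nat.cast_mul]
    congr 1
    have h' : ((∑ i : Fin p, (p + 1 - (i : ℕ)) : ℕ) : ℝ) = p * (p + 3) / 2 := by
      push_cast at h ⊢
      linarith
    rw [h']
    push_cast
    field_simp
    ring
  obtain ⟨hfin, hcard⟩ := boundedGenerators_ncard_le k hp (one_le_mul_of_one_le_of_one_le hD1 hY1)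
  have hsubset : {K | k ⋖ K ∧ Module.finrank ℚ K = d * (p + 1) ∧ |(fieldDiscr K : ℝ)| ≤ X} ⊆
      (fun y => (k⟮y⟯).restrictScalars ℚ) '' boundedGenerators k (p + 1) (D * Y) := by
    rintro K ⟨hkK, hK, hdisc⟩
    have : FiniteDimensional ℚ K := Module.finite_of_finrank_pos (by rw [hK]; positivity)
    have : NumberField K := ⟨⟩
    rw [fieldDiscr_eq] at hdisc
    obtain ⟨x, hxK, hxk, hx, hxB⟩ := exists_integer_notMem hkK.lt hX hdisc hK hk (by nlinarith)
    have hle : k ≤ (k⟮x⟯).restrictScalars ℚ := fun z hz =>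
      _root_.algebraMap_mem k⟮x⟯ (⟨z, hz⟩ : k)
    have hgen : (k⟮x⟯).restrictScalars ℚ = K := by
      refine (hkK.eq_or_eq hle ?_).resolve_left ?_
      · have : k⟮x⟯ ≤ extendScalars hkK.le := adjoin_simple_le_iff.2 hxK
        exact fun z hz => this hz
      · intro h
        exact hxk (h ▸ mem_adjoin_simple_self k x)
    have hdeg : (minpoly k x).natDegree = p + 1 := by
      rw [← adjoin.finrank (Algebra.IsIntegral.isIntegral x)]
      have h1 : Module.finrank ℚ k⟮x⟯ = d * (p + 1) := by rw [← hK, ← hgen]; rfl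
      have h2 := Module.finrank_mul_finrank ℚ k k⟮x⟯
      rw [h1, hk] at h2
      exact Nat.eq_of_mul_eq_mul_left hd h2
    obtain ⟨y, hy, hyx⟩ := exists_boundedGenerators k hx hxB hdeg
    refine ⟨y, ?_, by rw [← hgen, ← hyx]⟩
    convert hy using 2
    rw [hsub, ← hY, hD]
    ring
  refine ⟨(hfin.image _).subset hsubset, ?_⟩
  calc _ ≤ ((boundedGenerators k (p + 1) (D * Y)).ncard : ℝ) := by
        exact_mod_cast (Set.ncard_le_ncard hsubset (hfin.image _)).trans (Set.ncard_image_le hfin)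
    _ ≤ _ := hcard
    _ = _ := by
      rw [← hYE, hk, mul_assoc ((p : ℝ) + 1), ← mul_pow, ← Finset.prod_pow_eq_pow_sum,
        ← Finset.prod_mul_distrib]
      congr 3 with i
      rw [mul_pow]
      ring

theorem exists_covBy_of_ne_bot {K : IntermediateField ℚ Qbar} [FiniteDimensional ℚ K]
    (hK : K ≠ ⊥) : ∃ k, k ⋖ K := by
  obtain ⟨k, hk, hmin⟩ := (measure fun k : IntermediateField ℚ Qbar =>
    Module.finrank ℚ K - Module.finrank ℚ k).wf.has_min {k | k < K} ⟨⊥, bot_lt_iff_ne_bot.2 hK⟩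
  have hlt : ∀ {k l : IntermediateField ℚ Qbar}, k < l → l ≤ K →
      Module.finrank ℚ k < Module.finrank ℚ l := fun {k l} hkl hlK => by
    have : FiniteDimensional ℚ l := FiniteDimensional.of_injective
      (IntermediateField.inclusion hlK).toLinearMap (IntermediateField.inclusion hlK).injective
    by_contra! h
    exact hkl.ne (IntermediateField.eq_of_le_of_finrank_le hkl.le h)
  refine ⟨k, hk, fun l hkl hlK => hmin l hlK ?_⟩
  have h1 := hlt hkl hlK.le
  have h2 := hlt hlK le_rfl
  change Module.finrank ℚ K - Module.finrank ℚ l < Module.finrank ℚ K - Module.finrank ℚ k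
  omega

theorem ncard_biUnion_le_mul {α β : Type*} {t : Set α} (ht : t.Finite) {s : α → Set β}
    {a b : ℝ} (ha : (t.ncard : ℝ) ≤ a) (hb : 0 ≤ b) (hs : ∀ i ∈ t, ((s i).ncard : ℝ) ≤ b) :
    ((⋃ i ∈ t, s i).ncard : ℝ) ≤ a * b := by
  have h := ht.toFinset.set_ncard_biUnion_le s
  simp only [Set.Finite.mem_toFinset] at h
  calc ((⋃ i ∈ t, s i).ncard : ℝ) ≤ ∑ i ∈ ht.toFinset, ((s i).ncard : ℝ) := by exact_mod_cast h
    _ ≤ ∑ i ∈ ht.toFinset, b := Finset.sum_le_sum fun i hi => hs i (by simpa using hi)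
    _ = t.ncard * b := by rw [Finset.sum_const, nsmul_eq_mul, Set.ncard_eq_toFinset_card t ht]
    _ ≤ a * b := by gcongr

/-- The number fields of degree `n` and absolute discriminant at most `X`. -/
def fieldsOfDegree (n : ℕ) (X : ℝ) : Set (IntermediateField ℚ Qbar) :=
  {K | Module.finrank ℚ K = n ∧ |(fieldDiscr K : ℝ)| ≤ X}

theorem fieldsOfDegree_one_subset (X : ℝ) : fieldsOfDegree 1 X ⊆ {⊥} := fun _ hK =>
  IntermediateField.finrank_eq_one_iff.1 hK.1

theorem mem_fieldsOfDegree_of_le {k K : IntermediateField ℚ Qbar} (h : k ≤ K) {d m : ℕ}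
    (hd : 0 < d) (hm : 0 < m) (hk : Module.finrank ℚ k = d) {X : ℝ}
    (hK : K ∈ fieldsOfDegree (d * m) X) : k ∈ fieldsOfDegree d (X ^ (m : ℝ)⁻¹) := by
  have : FiniteDimensional ℚ k := Module.finite_of_finrank_pos (by omega)
  have : FiniteDimensional ℚ K := Module.finite_of_finrank_pos (by rw [hK.1]; positivity)
  have : NumberField k := ⟨⟩
  have : NumberField K := ⟨⟩
  refine ⟨hk, ?_⟩
  have h1 := (abs_discr_pow_le h (m := m) (by rw [hk, hK.1])).trans (fieldDiscr_eq K ▸ hK.2)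
  rw [fieldDiscr_eq, ← Real.pow_rpow_inv_natCast (abs_nonneg _) hm.ne']
  exact Real.rpow_le_rpow (by positivity) h1 (by positivity)

theorem exists_ncard_fieldsOfDegree_inter_le {d m : ℕ} (hd : 0 < d) (hm : 2 ≤ m)
    (hc : ∃ c : ℝ, 0 < c ∧ ∀ X : ℝ, 1 ≤ X → (fieldsOfDegree d X).Finite ∧
      ((fieldsOfDegree d X).ncard : ℝ) ≤ c * X ^ (((d : ℝ) + 2) / 4)) :
    ∃ c : ℝ, 0 < c ∧ ∀ X : ℝ, 1 ≤ X →
      {K ∈ fieldsOfDegree (d * m) X | ∃ k, k ⋖ K ∧ Module.finrank ℚ k = d}.Finite ∧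
      ({K ∈ fieldsOfDegree (d * m) X | ∃ k, k ⋖ K ∧ Module.finrank ℚ k = d}.ncard : ℝ) ≤
        c * X ^ ((((d * m : ℕ) : ℝ) + 2) / 4) := by
  have hm' : (2 : ℝ) ≤ m := by exact_mod_cast hm
  obtain ⟨c, hc0, hc⟩ : ∃ c : ℝ, 0 < c ∧ ∀ X : ℝ, 1 ≤ X →
      (fieldsOfDegree d (X ^ (m : ℝ)⁻¹)).Finite ∧
      ((fieldsOfDegree d (X ^ (m : ℝ)⁻¹)).ncard : ℝ) ≤ c * X ^ (((d : ℝ) * m - m) / 4) := by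
    obtain rfl | hd2 : d = 1 ∨ 2 ≤ d := by omega
    · refine ⟨1, one_pos, fun X hX => ?_⟩
      have hsub := fieldsOfDegree_one_subset (X ^ (m : ℝ)⁻¹)
      refine ⟨(Set.finite_singleton _).subset hsub, ?_⟩
      simpa using Set.ncard_le_ncard hsub
    · obtain ⟨c, hc0, hc⟩ := hc
      refine ⟨c, hc0, fun X hX => ?_⟩
      obtain ⟨hfin, hcard⟩ := hc (X ^ (m : ℝ)⁻¹) (Real.one_le_rpow hX (by positivity))
      refine ⟨hfin, hcard.trans ?_⟩
      rw [← Real.rpow_mul (by linarith)]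
      gcongr
      have hd2' : (2 : ℝ) ≤ d := by exact_mod_cast hd2
      rw [inv_mul_le_iff₀ (by linarith)]
      nlinarith [mul_le_mul hm' hm' (by norm_num) (by linarith)]
  obtain ⟨C, hC0, hC⟩ := exists_ncard_covBy_le hd hm
  refine ⟨c * C, by positivity, fun X hX => ?_⟩
  obtain ⟨hfin, hcard⟩ := hc X hX
  have hsub : {K ∈ fieldsOfDegree (d * m) X | ∃ k, k ⋖ K ∧ Module.finrank ℚ k = d} ⊆
      ⋃ k ∈ fieldsOfDegree d (X ^ (m : ℝ)⁻¹),
        {K | k ⋖ K ∧ Module.finrank ℚ K = d * m ∧ |(fieldDiscr K : ℝ)| ≤ X} := by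
    rintro K ⟨hK, k, hkK, hk⟩
    exact Set.mem_biUnion (mem_fieldsOfDegree_of_le hkK.le hd (by omega) hk hK) ⟨hkK, hK⟩
  have hfin' := hfin.biUnion fun k hk => (hC k hk.1 X hX).1
  refine ⟨hfin'.subset hsub, ?_⟩
  calc _ ≤ (_ : ℝ) := Nat.cast_le.2 (Set.ncard_le_ncard hsub hfin')
    _ ≤ c * X ^ (((d : ℝ) * m - m) / 4) * (C * X ^ (((m : ℝ) + 2) / 4)) :=
      ncard_biUnion_le_mul hfin hcard (by positivity) fun k hk => (hC k hk.1 X hX).2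
    _ = c * C * (X ^ (((d : ℝ) * m - m) / 4) * X ^ (((m : ℝ) + 2) / 4)) := by ring
    _ = _ := by
      rw [← Real.rpow_add (by linarith)]
      congr 2
      push_cast
      ring

theorem exists_ncard_fieldsOfDegree_le (n : ℕ) (hn : 0 < n) :
    ∃ c : ℝ, 0 < c ∧ ∀ X : ℝ, 1 ≤ X → (fieldsOfDegree n X).Finite ∧
      ((fieldsOfDegree n X).ncard : ℝ) ≤ c * X ^ (((n : ℝ) + 2) / 4) := by
  induction n using Nat.strong_induction_on with
  | _ n ih =>
  obtain rfl | hn1 := eq_or_ne n 1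
  · refine ⟨1, one_pos, fun X hX => ?_⟩
    have hsub := fieldsOfDegree_one_subset X
    refine ⟨(Set.finite_singleton _).subset hsub, ?_⟩
    calc ((fieldsOfDegree 1 X).ncard : ℝ) ≤ 1 := by simpa using Set.ncard_le_ncard hsub
      _ ≤ _ := by rw [one_mul]; exact Real.one_le_rpow hX (by positivity)
  have key : ∀ d ∈ n.properDivisors, ∃ c : ℝ, 0 < c ∧ ∀ X : ℝ, 1 ≤ X →
      {K ∈ fieldsOfDegree n X | ∃ k, k ⋖ K ∧ Module.finrank ℚ k = d}.Finite ∧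
      ({K ∈ fieldsOfDegree n X | ∃ k, k ⋖ K ∧ Module.finrank ℚ k = d}.ncard : ℝ) ≤
        c * X ^ (((n : ℝ) + 2) / 4) := by
    intro d hd
    obtain ⟨⟨m, rfl⟩, hdn⟩ := Nat.mem_properDivisors.1 hd
    have hd0 : 0 < d := Nat.pos_of_mul_pos_right hn
    exact exists_ncard_fieldsOfDegree_inter_le hd0 (by by_contra!; interval_cases m <;> omega)
      (ih d hdn hd0)
  choose! c hc0 hc using key
  have hone : 1 ∈ n.properDivisors := Nat.one_mem_properDivisors_iff_one_lt.2 (by omega)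
  refine ⟨∑ d ∈ n.properDivisors, c d, Finset.sum_pos hc0 ⟨1, hone⟩, fun X hX => ?_⟩
  have hsub : fieldsOfDegree n X ⊆ ⋃ d ∈ n.properDivisors,
      {K ∈ fieldsOfDegree n X | ∃ k, k ⋖ K ∧ Module.finrank ℚ k = d} := by
    intro K hK
    have : FiniteDimensional ℚ K := Module.finite_of_finrank_pos (by rw [hK.1]; exact hn)
    obtain ⟨k, hk⟩ := exists_covBy_of_ne_bot (K := K) fun h =>
      hn1 (hK.1 ▸ IntermediateField.finrank_eq_one_iff.2 h)
    refine Set.mem_biUnion (x := Module.finrank ℚ k) ?_ ⟨hK, k, hk, rfl⟩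
    have hmul := IntermediateField.finrank_bot_mul_relfinrank hk.le
    rw [hK.1] at hmul
    refine Nat.mem_properDivisors.2 ⟨⟨_, hmul.symm⟩, ?_⟩
    by_contra! h
    exact hk.lt.ne (IntermediateField.eq_of_le_of_finrank_le hk.le (hK.1 ▸ h))
  have hfin : (⋃ d ∈ n.properDivisors,
      {K ∈ fieldsOfDegree n X | ∃ k, k ⋖ K ∧ Module.finrank ℚ k = d}).Finite :=
    n.properDivisors.finite_toSet.biUnion fun d hd => (hc d hd X hX).1
  refine ⟨hfin.subset hsub, ?_⟩
  calc _ ≤ (_ : ℝ) := Nat.cast_le.2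
        ((Set.ncard_le_ncard hsub hfin).trans (Finset.set_ncard_biUnion_le _ _))
    _ ≤ _ := by
      rw [Nat.cast_sum, Finset.sum_mul]
      exact Finset.sum_le_sum fun d hd => (hc d hd X hX).2

/-- (Schmidt's bound.) For `n ≥ 2`, `F_n(X) ≪_n X^{(n+2)/4}`. -/
theorem schmidt_bound (n : ℕ) (hn : 2 ≤ n) :
    ∃ c : ℝ, 0 < c ∧ ∀ X : ℝ, 2 ≤ X →
      (FnAll n X : ℝ) ≤ c * X ^ (((n : ℝ) + 2) / 4) := by
  obtain ⟨c, hc0, hc⟩ := exists_ncard_fieldsOfDegree_le n (by omega)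
  exact ⟨c, hc0, fun X hX => (hc X (by linarith)).2⟩
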